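/- arXiv:1212.5022 — 2 statements merged into one kernel-verified Lean document; each statement's English description precedes it below -/
import Mathlib

section
/- Let l, m, n be nonnegative integers with gcd(l,m) = gcd(l,n) = 1. Then the orbit space 𝔑^l_{m,n} of the circle action on 𝕊³_ℍ × 𝕊³, equipped with the quotient topology, is a simply connected topological space. -/
noncomputable section

open Quaternion

/-- The embedding of `ℂ` into the quaternions, sending `a + b·i` to the quaternion `a + b·i`. -/
def cq (x : ℂ) : Quaternion ℝ := ⟨x.re, x.im, 0, 0⟩

/-- The total space `𝕊³_ℍ × 𝕊³`: pairs of a unit quaternion and a point `(z,w) ∈ ℂ²`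
with `|z|² + |w|² = 1`. -/
abbrev TotalSpace : Type :=
  {a : Quaternion ℝ × (ℂ × ℂ) // ‖a.1‖ = 1 ∧ Complex.normSq a.2.1 + Complex.normSq a.2.2 = 1}

/-- The circle action `x · (p,(z,w)) = (p x^l, (x^m z, x^n w))` on the ambient space. -/
def circleAct (l m n : ℕ) (x : Circle) (a : Quaternion ℝ × (ℂ × ℂ)) :
    Quaternion ℝ × (ℂ × ℂ) :=
  (a.1 * cq ((x : ℂ) ^ l), ((x : ℂ) ^ m * a.2.1, (x : ℂ) ^ n * a.2.2))

/-- The orbit relation of the circle action on `𝕊³_ℍ × 𝕊³`. -/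
def NRel (l m n : ℕ) (a b : TotalSpace) : Prop :=
  ∃ x : Circle, circleAct l m n x a.1 = b.1

/-- The orbit space `𝔑^l_{m,n}`, with the quotient topology. -/
abbrev NSpace (l m n : ℕ) : Type := Quot (NRel l m n)


open scoped unitInterval
open Topology
open Metric Module

section Sphere

variable {E : Type*} [NormedAddCommGroup E] [InnerProductSpace ℝ E]

/-- The radial projection of a nonvanishing map onto the unit sphere. -/
def sphereNormalize {X : Type*} [TopologicalSpace X] (f : C(X, E)) (hf : ∀ x, f x ≠ 0) :
    C(X, sphere (0 : E) 1) where
  toFun x := ⟨‖f x‖⁻¹ • f x, by simp [norm_smul, hf x]⟩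
  continuous_toFun := by
    have h (x : X) : ‖f x‖ ≠ 0 := norm_ne_zero_iff.2 (hf x)
    exact Continuous.subtype_mk (by fun_prop (disch := exact h)) _

lemma sphereNormalize_of_eq {X : Type*} [TopologicalSpace X] (f : C(X, E)) (hf : ∀ x, f x ≠ 0)
    {x : X} {y : sphere (0 : E) 1} (h : f x = y) : sphereNormalize f hf x = y := by
  ext
  simp [sphereNormalize, h]

lemma isSimplyConnected_compl_singleton_sphere (v : sphere (0 : E) 1) :
    IsSimplyConnected ({v}ᶜ : Set (sphere (0 : E) 1)) := by
  have e : ({v}ᶜ : Set (sphere (0 : E) 1)) ≃ₜ (ℝ ∙ (v : E))ᗮ :=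
    (stereographic (norm_eq_of_mem_sphere v)).toHomeomorphSourceTarget.trans
      (Homeomorph.Set.univ _)
  exact e.toHomotopyEquiv.simplyConnectedSpace

lemma add_smul_sub_ne_zero {a b : E} (ha : ‖a‖ = 1) (hab : ‖b - a‖ < 1) (s : I) :
    a + (s : ℝ) • (b - a) ≠ 0 := by
  intro h
  have h₁ : a = -((s : ℝ) • (b - a)) := eq_neg_of_add_eq_zero_left h
  have h₂ : ‖a‖ ≤ ‖b - a‖ := by
    rw [h₁, norm_neg, norm_smul, Real.norm_of_nonneg s.2.1, ← h₁]
    exact mul_le_of_le_one_left (norm_nonneg _) s.2.2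
  linarith

/-- Polynomial curves are dense among the continuous curves with given endpoints. -/
lemma exists_contDiff_near (f : C(I, E)) {ε : ℝ} (hε : 0 < ε) :
    ∃ g : ℝ → E, ContDiff ℝ 1 g ∧ g 0 = f 0 ∧ g 1 = f 1 ∧ ∀ t : I, ‖g t - f t‖ < ε := by
  obtain ⟨N, hN⟩ := Metric.tendsto_atTop.1 (bernsteinApproximation_uniform f) ε hε
  let B := bernsteinApproximation (N + 1) f
  let g : ℝ → E := fun t ↦ ∑ k : Fin (N + 1 + 1),
    (((N + 1).choose k : ℝ) * t ^ (k : ℕ) * (1 - t) ^ (N + 1 - k : ℕ)) • f (bernstein.z k)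
  have hg (t : I) : g t = B t := by
    simp [g, B, bernsteinApproximation.apply, bernstein_apply]
  refine ⟨g, by fun_prop, ?_, ?_, fun t ↦ ?_⟩
  · simpa [B] using hg 0
  · simpa [B] using hg 1
  · rw [hg, ← dist_eq_norm]
    exact (ContinuousMap.dist_apply_le_dist t).trans_lt (hN (N + 1) N.le_succ)

theorem simplyConnectedSpace_sphere [FiniteDimensional ℝ E] (hE : 2 < finrank ℝ E) :
    SimplyConnectedSpace (sphere (0 : E) 1) := by
  rw [simply_connected_iff_loops_nullhomotopic]
  refine ⟨isPathConnected_iff_pathConnectedSpace.1 (isPathConnected_sphere ?_ 0 zero_le_one),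
    fun x γ ↦ ?_⟩
  · rw [← finrank_eq_rank]
    exact_mod_cast one_lt_two.trans hE
  obtain ⟨g, hg, g_zero, g_one, hgγ⟩ := exists_contDiff_near
    ⟨fun t ↦ (γ t : E), by fun_prop⟩ one_pos
  simp only [ContinuousMap.coe_mk, γ.source, γ.target] at g_zero g_one hgγ
  let F : C(I × I, E) := ⟨fun p ↦ γ p.2 + (p.1 : ℝ) • (g p.2 - γ p.2), by
    have := hg.continuous
    fun_prop⟩
  have hF (p) : F p ≠ 0 :=
    add_smul_sub_ne_zero (norm_eq_of_mem_sphere _) (hgγ p.2) p.1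
  have hF_zero (s : I) : sphereNormalize F hF (s, 0) = x :=
    sphereNormalize_of_eq F hF (by simp [F, g_zero])
  have hF_one (s : I) : sphereNormalize F hF (s, 1) = x :=
    sphereNormalize_of_eq F hF (by simp [F, g_one])
  let δ : Path x x :=
    { toFun := fun t ↦ sphereNormalize F hF (1, t)
      source' := hF_zero 1
      target' := hF_one 1 }
  have hγδ : γ.Homotopic δ := ⟨
    { toContinuousMap := sphereNormalize F hF
      map_zero_left := fun t ↦ sphereNormalize_of_eq F hF (by simp [F])
      map_one_left := fun t ↦ rfl
      prop' := by
        rintro s t (rfl | rfl)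
        · exact (hF_zero s).trans γ.source.symm
        · exact (hF_one s).trans γ.target.symm }⟩
  refine hγδ.trans ?_
  -- The cone over the smooth curve `g` is at most two-dimensional, so it misses a direction.
  obtain ⟨v, hv⟩ : ((Set.range fun p : ℝ × ℝ ↦ p.1 • g p.2)ᶜ).Nonempty :=
    (ContDiff.dense_compl_range_of_finrank_lt_finrank (by fun_prop)
      (by simpa using hE)).nonempty
  have hv' (r t : ℝ) : r • g t ≠ v := fun h ↦ hv ⟨(r, t), h⟩
  have hv0 : v ≠ 0 := fun h ↦ hv' 0 0 (by simp [h])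
  let u : sphere (0 : E) 1 := ⟨‖v‖⁻¹ • v, by simp [norm_smul, hv0]⟩
  obtain ⟨H, -⟩ := (isSimplyConnected_iff_exists_homotopy_refl_forall_mem.1
    (isSimplyConnected_compl_singleton_sphere u)).2 x δ fun t h ↦ by
      have h₁ : ‖g t‖⁻¹ • g t = ‖v‖⁻¹ • v := by
        simpa [δ, sphereNormalize, F, u, -smul_add] using congrArg Subtype.val h
      apply hv' (‖v‖ * ‖g t‖⁻¹) t
      rw [mul_smul, h₁, smul_inv_smul₀ (norm_ne_zero_iff.2 hv0)]
  exact ⟨H⟩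

end Sphere

theorem SimplyConnectedSpace.prod {X Y : Type*} [TopologicalSpace X] [TopologicalSpace Y]
    [SimplyConnectedSpace X] [SimplyConnectedSpace Y] : SimplyConnectedSpace (X × Y) := by
  rw [simply_connected_iff_paths_homotopic]
  refine ⟨inferInstance, fun x y ↦ ⟨fun p q ↦ ?_⟩⟩
  rw [← Path.Homotopic.prod_projLeft_projRight p, ← Path.Homotopic.prod_projLeft_projRight q]
  congr 1 <;> exact Subsingleton.elim _ _

section OrbitSpace

variable {G P N : Type*} [Group G] [TopologicalSpace G]
  [TopologicalSpace P] [TopologicalSpace N] [MulAction G P] [ContinuousSMul G P] {π : P → N}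

/-- An equivariant map to the group, defined on an invariant open set, yields a local section of
the orbit map. -/
lemma exists_localSection [IsTopologicalGroup G] (hπ : IsQuotientMap π)
    (orbit : ∀ a b, π a = π b ↔ ∃ g : G, g • a = b)
    (slice : ∀ a, ∃ U : Set P, IsOpen U ∧ a ∈ U ∧ ∃ φ : P → G, ContinuousOn φ U ∧
      ∀ (g : G), ∀ b ∈ U, g • b ∈ U ∧ φ (g • b) = g * φ b) (y : N) :
    ∃ V : Set N, IsOpen V ∧ y ∈ V ∧ ∃ s : N → P, ContinuousOn s V ∧ ∀ x, π (s x) = x := by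
  obtain ⟨a, rfl⟩ := hπ.surjective y
  obtain ⟨U, hU, haU, φ, hφ, hUφ⟩ := slice a
  have hpre : π ⁻¹' (π '' U) = U := by
    refine Set.Subset.antisymm ?_ (Set.subset_preimage_image π U)
    rintro b ⟨c, hc, hcb⟩
    obtain ⟨g, rfl⟩ := (orbit c b).1 hcb
    exact (hUφ g c hc).1
  have hV : IsOpen (π '' U) := by rwa [← hπ.isOpen_preimage, hpre]
  have hinv (g : G) (b : P) : π (g • b) = π b := ((orbit _ _).2 ⟨g, rfl⟩).symm
  have hq := Function.surjInv_eq hπ.surjective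
  set q := Function.surjInv hπ.surjective
  refine ⟨π '' U, hV, ⟨a, haU, rfl⟩, fun x ↦ (φ (q x))⁻¹ • q x, ?_, fun x ↦ ?_⟩
  · rw [hπ.continuousOn_isOpen_iff hV, hpre]
    refine (hφ.inv.smul continuousOn_id).congr fun b hb ↦ ?_
    obtain ⟨g, hg⟩ := (orbit b (q (π b))).1 (hq _).symm
    simp [← hg, (hUφ g b hb).2, mul_smul]
  · rw [hinv, hq]

/-- Path lifting for orbit maps admitting local sections. -/
lemma exists_pathLift (orbit : ∀ a b, π a = π b ↔ ∃ g : G, g • a = b)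
    (sec : ∀ y : N, ∃ V : Set N, IsOpen V ∧ y ∈ V ∧
      ∃ s : N → P, ContinuousOn s V ∧ ∀ x, π (s x) = x)
    (γ : C(I, N)) (e : P) (he : π e = γ 0) : ∃ Γ : C(I, P), (∀ t, π (Γ t) = γ t) ∧ Γ 0 = e := by
  have hinv (g : G) (b : P) : π (g • b) = π b := ((orbit _ _).2 ⟨g, rfl⟩).symm
  choose V V_open mem_V s hs πs using sec
  obtain ⟨t, t_zero, t_mono, ⟨n_max, h_max⟩, t_sub⟩ :=
    exists_monotone_Icc_subset_open_cover_unitInterval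
      (fun x ↦ (V_open x).preimage γ.continuous) fun t _ ↦ Set.mem_iUnion.2 ⟨γ t, mem_V _⟩
  suffices ∀ n, ∃ Γ : I → P, ContinuousOn Γ (Set.Icc 0 (t n)) ∧
      (∀ r ∈ Set.Icc 0 (t n), π (Γ r) = γ r) ∧ Γ 0 = e by
    obtain ⟨Γ, cont, lifts, Γ_zero⟩ := this n_max
    have huniv : Set.Icc (0 : I) (t n_max) = Set.univ := by
      rw [h_max _ le_rfl]
      exact Set.eq_univ_of_forall fun r ↦ ⟨bot_le, le_top⟩
    rw [huniv] at cont lifts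
    exact ⟨⟨Γ, continuousOn_univ.1 cont⟩, fun r ↦ lifts r trivial, Γ_zero⟩
  intro n
  induction n with
  | zero =>
    refine ⟨fun _ ↦ e, continuousOn_const, fun r hr ↦ ?_, rfl⟩
    rw [t_zero, Set.Icc_self, Set.mem_singleton_iff] at hr
    rw [hr, he]
  | succ n ih =>
    obtain ⟨Γ, cont, lifts, Γ_zero⟩ := ih
    obtain ⟨x, hx⟩ := t_sub n
    have hn : (0 : I) ≤ t n := bot_le
    obtain ⟨g, hg⟩ := (orbit (s x (γ (t n))) (Γ (t n))).1
      (by rw [πs, lifts _ ⟨hn, le_rfl⟩])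
    refine ⟨fun r ↦ if r ≤ t n then Γ r else g • s x (γ r),
      .if (fun r hr ↦ ?_) (cont.mono fun r hr ↦ ?_) ?_, fun r hr ↦ ?_, ?_⟩
    · cases frontier_Iic_subset _ hr.2
      exact hg.symm
    · rw [closure_le_eq continuous_id' continuous_const] at hr
      exact ⟨hr.1.1, hr.2⟩
    · refine ((hs x).comp γ.continuous.continuousOn fun r hr ↦ hx ?_).const_smul g
      simp_rw [not_le] at hr
      exact ⟨closure_lt_subset_le continuous_const continuous_subtype_val hr.2, hr.1.2⟩
    · dsimp only
      split_ifs with h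
      · exact lifts r ⟨hr.1, h⟩
      · rw [hinv, πs]
    · simpa [hn] using Γ_zero

/-- The orbit space of a principal action of a path connected group on a simply connected space
is simply connected. -/
theorem simplyConnectedSpace_of_orbitMap [IsTopologicalGroup G] [PathConnectedSpace G]
    [SimplyConnectedSpace P]
    (hπ : IsQuotientMap π) (orbit : ∀ a b, π a = π b ↔ ∃ g : G, g • a = b)
    (slice : ∀ a, ∃ U : Set P, IsOpen U ∧ a ∈ U ∧ ∃ φ : P → G, ContinuousOn φ U ∧
      ∀ (g : G), ∀ b ∈ U, g • b ∈ U ∧ φ (g • b) = g * φ b) :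
    SimplyConnectedSpace N := by
  rw [simply_connected_iff_loops_nullhomotopic]
  refine ⟨hπ.surjective.pathConnectedSpace hπ.continuous, fun x γ ↦ ?_⟩
  obtain ⟨a, rfl⟩ := hπ.surjective x
  obtain ⟨Γ, lifts, Γ_zero⟩ := exists_pathLift orbit (exists_localSection hπ orbit slice)
    γ.toContinuousMap a γ.source.symm
  obtain ⟨g, hg⟩ := (orbit (Γ 1) a).1 ((lifts 1).trans γ.target)
  let Γ' : Path a (Γ 1) := ⟨Γ, Γ_zero, rfl⟩
  let c : Path (1 : G) g := PathConnectedSpace.somePath 1 g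
  let δ : Path (Γ 1) a := ⟨⟨fun t ↦ c t • Γ 1, by fun_prop⟩, by simp, by simpa using hg⟩
  have hb : π (Γ 1) = π a := (lifts 1).trans γ.target
  have hΓ : (Γ'.map hπ.continuous).cast rfl hb.symm = γ := by
    ext t
    exact lifts t
  have hδ : (δ.map hπ.continuous).cast hb.symm rfl = Path.refl (π a) := by
    ext t
    exact ((orbit _ _).2 ⟨c t, rfl⟩).symm.trans hb
  have hmap : (Γ'.trans δ).map hπ.continuous = γ.trans (Path.refl (π a)) := by
    rw [← hδ, ← hΓ, Path.map_trans]
    rfl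
  have hnull : ((Γ'.trans δ).map hπ.continuous).Homotopic ((Path.refl a).map hπ.continuous) :=
    (SimplyConnectedSpace.paths_homotopic _ _).map ⟨π, hπ.continuous⟩
  rw [hmap] at hnull
  exact (Path.Homotopic.symm ⟨Path.Homotopy.transRefl γ⟩).trans hnull

end OrbitSpace

section Phase

/-- The phase `z / |z|` of a nonzero complex number, with value `1` at `z = 0`. -/
def phase (z : ℂ) : Circle :=
  if hz : z = 0 then 1 else ⟨z / ‖z‖, by simp [Submonoid.unitSphere, hz]⟩

lemma coe_phase {z : ℂ} (hz : z ≠ 0) : (phase z : ℂ) = z / ‖z‖ := by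
  simp [phase, hz]

lemma phase_mul (x : Circle) {z : ℂ} (hz : z ≠ 0) : phase (x * z) = x * phase z := by
  ext
  rw [coe_phase (mul_ne_zero x.coe_ne_zero hz), Circle.coe_mul, coe_phase hz]
  rw [norm_mul, Circle.norm_coe, one_mul, mul_div_assoc]

lemma continuousOn_phase : ContinuousOn phase {0}ᶜ := by
  refine (IsInducing.continuousOn_iff (g := fun x : Circle ↦ (x : ℂ)) ⟨rfl⟩).2 ?_
  refine ContinuousOn.congr (f := fun z : ℂ ↦ z / ‖z‖) ?_ fun z hz ↦ coe_phase hz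
  exact continuousOn_id.div (by fun_prop) fun z hz ↦ by simpa using hz

/-- Two nonvanishing coordinates of coprime weights combine to a map of weight one to the
circle. -/
lemma exists_slice_of_coprime_weights {P : Type*} [TopologicalSpace P] [MulAction Circle P]
    {k l : ℕ} (hkl : Nat.gcd k l = 1) {c d : P → ℂ} (hc : Continuous c) (hd : Continuous d)
    (hck : ∀ (x : Circle) a, c (x • a) = (x : ℂ) ^ k * c a)
    (hdl : ∀ (x : Circle) a, d (x • a) = (x : ℂ) ^ l * d a) {a : P} (hca : c a ≠ 0)
    (hda : d a ≠ 0) :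
    ∃ U : Set P, IsOpen U ∧ a ∈ U ∧ ∃ φ : P → Circle, ContinuousOn φ U ∧
      ∀ (x : Circle), ∀ b ∈ U, x • b ∈ U ∧ φ (x • b) = x * φ b := by
  refine ⟨{b | c b ≠ 0} ∩ {b | d b ≠ 0},
    (isOpen_ne_fun hc continuous_const).inter (isOpen_ne_fun hd continuous_const), ⟨hca, hda⟩,
    fun b ↦ phase (c b) ^ k.gcdA l * phase (d b) ^ k.gcdB l, ?_, ?_⟩
  · exact ((continuousOn_phase.comp hc.continuousOn fun b hb ↦ hb.1).zpow _).mul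
      ((continuousOn_phase.comp hd.continuousOn fun b hb ↦ hb.2).zpow _)
  · rintro x b ⟨hcb, hdb⟩
    refine ⟨⟨?_, ?_⟩, ?_⟩
    · simpa [hck] using hcb
    · simpa [hdl] using hdb
    · have bezout : (k : ℤ) * k.gcdA l + l * k.gcdB l = 1 := by
        rw [← Nat.gcd_eq_gcd_ab, hkl, Nat.cast_one]
      have hx : (x ^ k) ^ k.gcdA l * (x ^ l) ^ k.gcdB l = x := by
        rw [← zpow_natCast, ← zpow_natCast, ← zpow_mul, ← zpow_mul, ← zpow_add, bezout, zpow_one]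
      dsimp only
      rw [hck, hdl, ← Circle.coe_pow, ← Circle.coe_pow, phase_mul _ hcb, phase_mul _ hdb,
        mul_zpow, mul_zpow, mul_mul_mul_comm, hx]

end Phase

section TotalSpace

lemma cq_eq_coe (x : ℂ) : cq x = (x : ℍ[ℝ]) := rfl

lemma norm_cq (x : ℂ) : ‖cq x‖ = ‖x‖ := by
  rw [← sq_eq_sq₀ (norm_nonneg _) (norm_nonneg _), ← Complex.normSq_eq_norm_sq, sq,
    ← Quaternion.normSq_eq_norm_mul_self, Quaternion.normSq_def', Complex.normSq_apply]
  simp [cq, sq]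

/-- The circle action on `𝕊³_ℍ × 𝕊³`. -/
abbrev circleMulAction (l m n : ℕ) : MulAction Circle TotalSpace where
  smul x a := ⟨circleAct l m n x a.1, by
    obtain ⟨h₁, h₂⟩ := a.2
    have hx (k : ℕ) : ‖(x : ℂ) ^ k‖ = 1 := by rw [norm_pow, Circle.norm_coe, one_pow]
    constructor
    · rw [circleAct, norm_mul, norm_cq, hx, h₁, mul_one]
    · simp only [circleAct, Complex.normSq_mul]
      simpa only [Complex.normSq_eq_norm_sq, hx, one_pow, one_mul] using h₂⟩
  one_smul a := Subtype.ext <| by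
    change circleAct l m n 1 a.1 = a.1
    simp [circleAct, cq_eq_coe]
  mul_smul x y a := Subtype.ext <| by
    change circleAct l m n (x * y) a.1 = circleAct l m n x (circleAct l m n y a.1)
    refine Prod.ext ?_ (Prod.ext ?_ ?_)
    · simp only [circleAct, cq_eq_coe, Circle.coe_mul, mul_pow]
      rw [mul_comm, Quaternion.coeComplex_mul, mul_assoc]
    · simp [circleAct, mul_pow, mul_assoc]
    · simp [circleAct, mul_pow, mul_assoc]

lemma continuousSMul_circleMulAction (l m n : ℕ) :
    letI := circleMulAction l m n
    ContinuousSMul Circle TotalSpace := by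
  let := circleMulAction l m n
  refine ⟨Continuous.subtype_mk (f := fun p : Circle × TotalSpace ↦
    circleAct l m n p.1 p.2.1) ?_ _⟩
  have : Continuous cq := Quaternion.ofComplex.toLinearMap.continuous_of_finiteDimensional
  unfold circleAct
  fun_prop

/-- `𝕊³_ℍ × 𝕊³` as a product of unit spheres of inner product spaces. -/
def totalSpaceHomeomorph :
    TotalSpace ≃ₜ sphere (0 : ℍ[ℝ]) 1 × sphere (0 : WithLp 2 (ℂ × ℂ)) 1 where
  toFun a := (⟨a.1.1, by simpa using a.2.1⟩, ⟨WithLp.toLp 2 a.1.2, by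
    simpa [WithLp.prod_norm_eq_of_L2, Complex.normSq_eq_norm_sq] using a.2.2⟩)
  invFun b := ⟨(b.1, WithLp.ofLp b.2.1), by simp, by
    have h := norm_eq_of_mem_sphere b.2
    rw [WithLp.prod_norm_eq_of_L2, Real.sqrt_eq_one] at h
    rw [Complex.normSq_eq_norm_sq, Complex.normSq_eq_norm_sq]
    exact h⟩
  left_inv _ := rfl
  right_inv _ := rfl
  continuous_toFun := by fun_prop
  continuous_invFun := by fun_prop

lemma simplyConnectedSpace_totalSpace : SimplyConnectedSpace TotalSpace := by
  have h₁ : SimplyConnectedSpace (sphere (0 : ℍ[ℝ]) 1) :=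
    simplyConnectedSpace_sphere (by simp [Quaternion.finrank_eq_four])
  have h₂ : SimplyConnectedSpace (sphere (0 : WithLp 2 (ℂ × ℂ)) 1) :=
    simplyConnectedSpace_sphere (by
      simp [(WithLp.linearEquiv 2 ℝ (ℂ × ℂ)).finrank_eq])
  have := SimplyConnectedSpace.prod (X := sphere (0 : ℍ[ℝ]) 1)
    (Y := sphere (0 : WithLp 2 (ℂ × ℂ)) 1)
  exact totalSpaceHomeomorph.toHomotopyEquiv.simplyConnectedSpace

lemma exists_slice_circleMulAction {l m n : ℕ} (hlm : Nat.gcd l m = 1) (hln : Nat.gcd l n = 1)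
    (a : TotalSpace) :
    letI := circleMulAction l m n
    ∃ U : Set TotalSpace, IsOpen U ∧ a ∈ U ∧ ∃ φ : TotalSpace → Circle, ContinuousOn φ U ∧
      ∀ (x : Circle), ∀ b ∈ U, x • b ∈ U ∧ φ (x • b) = x * φ b := by
  let := circleMulAction l m n
  let u (b : TotalSpace) : ℂ := ⟨b.1.1.re, b.1.1.imI⟩
  let v (b : TotalSpace) : ℂ := ⟨b.1.1.imJ, -b.1.1.imK⟩
  have hsmul (x : Circle) (b : TotalSpace) : (x • b).1 = circleAct l m n x b.1 := rfl
  have hu_smul (x : Circle) b : u (x • b) = (x : ℂ) ^ l * u b := by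
    apply Complex.ext <;>
      simp [u, hsmul, circleAct, cq_eq_coe, Quaternion.re_mul, Quaternion.imI_mul] <;>
      ring
  have hv_smul (x : Circle) b : v (x • b) = (x : ℂ) ^ l * v b := by
    apply Complex.ext <;>
      simp [v, hsmul, circleAct, cq_eq_coe, Quaternion.imJ_mul, Quaternion.imK_mul] <;>
      ring
  have hu : Continuous u := by
    have h : u = fun b ↦ (b.1.1.re : ℂ) + b.1.1.imI * Complex.I := by
      funext b
      apply Complex.ext <;> simp [u]
    rw [h]
    have := Quaternion.continuous_re
    have := Quaternion.continuous_imI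
    fun_prop
  have hv : Continuous v := by
    have h : v = fun b ↦ (b.1.1.imJ : ℂ) - b.1.1.imK * Complex.I := by
      funext b
      apply Complex.ext <;> simp [v]
    rw [h]
    have := Quaternion.continuous_imJ
    have := Quaternion.continuous_imK
    fun_prop
  have huv : u a ≠ 0 ∨ v a ≠ 0 := by
    by_contra! h
    have h₁ : a.1.1 = 0 := by
      simp only [u, v, Complex.ext_iff] at h
      ext <;> simp_all
    simpa [h₁] using a.2.1
  have hzw : a.1.2.1 ≠ 0 ∨ a.1.2.2 ≠ 0 := by
    by_contra! h
    simpa [h.1, h.2] using a.2.2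
  have hz : Continuous fun b : TotalSpace ↦ b.1.2.1 := by fun_prop
  have hw : Continuous fun b : TotalSpace ↦ b.1.2.2 := by fun_prop
  rcases huv with hua | hva <;> rcases hzw with hza | hwa
  · exact exists_slice_of_coprime_weights hlm hu hz hu_smul (fun _ _ ↦ rfl) hua hza
  · exact exists_slice_of_coprime_weights hln hu hw hu_smul (fun _ _ ↦ rfl) hua hwa
  · exact exists_slice_of_coprime_weights hlm hv hz hv_smul (fun _ _ ↦ rfl) hva hza
  · exact exists_slice_of_coprime_weights hln hv hw hv_smul (fun _ _ ↦ rfl) hva hwa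

lemma nRel_iff {l m n : ℕ} {a b : TotalSpace} :
    letI := circleMulAction l m n
    NRel l m n a b ↔ ∃ x : Circle, x • a = b := by
  let := circleMulAction l m n
  exact exists_congr fun x ↦ (Subtype.ext_iff (a1 := x • a)).symm

lemma equivalence_nRel (l m n : ℕ) : Equivalence (NRel l m n) := by
  let := circleMulAction l m n
  refine ⟨fun a ↦ nRel_iff.2 ⟨1, one_smul _ a⟩, fun {a b} h ↦ ?_, fun {a b c} hab hbc ↦ ?_⟩
  · obtain ⟨x, rfl⟩ := nRel_iff.1 h
    exact nRel_iff.2 ⟨x⁻¹, inv_smul_smul x a⟩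
  · obtain ⟨x, rfl⟩ := nRel_iff.1 hab
    obtain ⟨y, rfl⟩ := nRel_iff.1 hbc
    exact nRel_iff.2 ⟨y * x, mul_smul y x a⟩

end TotalSpace

/-- **Simple connectedness of `𝔑^l_{m,n}`.**
If `gcd(l,m) = gcd(l,n) = 1`, then the orbit space `𝔑^l_{m,n}` of the circle action on
`𝕊³_ℍ × 𝕊³`, with the quotient topology, is simply connected. -/
theorem NSpace_simplyConnected (l m n : ℕ) (hlm : Nat.gcd l m = 1) (hln : Nat.gcd l n = 1) :
    SimplyConnectedSpace (NSpace l m n) := by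
  let := circleMulAction l m n
  have := continuousSMul_circleMulAction l m n
  have := simplyConnectedSpace_totalSpace
  have : PathConnectedSpace Circle :=
    Circle.exp_surjective.pathConnectedSpace Circle.exp.continuous
  refine simplyConnectedSpace_of_orbitMap (G := Circle) isQuotientMap_quot_mk (fun a b ↦ ?_)
    (exists_slice_circleMulAction hlm hln)
  rw [Quot.eq, (equivalence_nRel l m n).eqvGen_iff, nRel_iff]
end
end

section
/- Let K be a finite subgroup of the rotation group SO(3) (the group of 3×3 real orthogonal matrices of determinant 1) and let N be a normal subgroup of K such that K/N is cyclic of order n for some n ≥ 3. Then either K is cyclic, or N is isomorphic to the Klein four-group ℤ/2 × ℤ/2 and K is isomorphic to the tetrahedral group, i.e., the alternating group A₄ on four letters. -/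
noncomputable section

open MulAction Matrix

theorem card_fiber_mul_card_of_surjective {H Q : Type*} [Group H] [Group Q] [Finite H]
    (f : H →* Q) (hf : Function.Surjective f) (q : Q) :
    Nat.card {h // f h = q} * Nat.card Q = Nat.card H := by
  obtain ⟨h₀, rfl⟩ := hf q
  have e : {h // f h = f h₀} ≃ f.ker :=
    { toFun := fun h => ⟨h₀⁻¹ * h.1, by simp [MonoidHom.mem_ker, h.2]⟩
      invFun := fun k => ⟨h₀ * k.1, by simp [MonoidHom.mem_ker.1 k.2]⟩
      left_inv := fun h => by simp
      right_inv := fun k => by simp }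
  rw [Nat.card_congr e, ← Nat.card_congr (QuotientGroup.quotientKerEquivOfSurjective f hf).toEquiv,
    mul_comm, ← Subgroup.card_eq_card_quotient_mul_card_subgroup]

theorem sum_card_fixing_eq_two_mul {G X : Type*} [Group G] [MulAction G X] [Finite G] [Fintype X]
    (h2 : ∀ g : G, g ≠ 1 → Nat.card (fixedBy X g) = 2) (p : G → Prop) (hp : ¬ p 1) :
    ∑ x : X, Nat.card {g : stabilizer G x // p g} = 2 * Nat.card {g // p g} := by
  have := Fintype.ofFinite {g // p g}
  have e : (Σ x : X, {g : stabilizer G x // p g}) ≃ Σ g : {g // p g}, fixedBy X g.1 :=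
    { toFun := fun y => ⟨⟨y.2.1.1, y.2.2⟩, ⟨y.1, y.2.1.2⟩⟩
      invFun := fun y => ⟨y.2.1, ⟨⟨y.1.1, y.2.2⟩, y.1.2⟩⟩
      left_inv := fun y => rfl
      right_inv := fun y => rfl }
  rw [← Nat.card_sigma, Nat.card_congr e, Nat.card_sigma,
    Finset.sum_const_nat fun g _ => h2 g.1 fun h => hp (h ▸ g.2)]
  simp [mul_comm]

theorem card_ne_one_add_one (H : Type*) [Group H] [Finite H] :
    Nat.card {h : H // h ≠ 1} + 1 = Nat.card H := by
  have := Fintype.ofFinite H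
  classical
  have := Fintype.card_pos (α := H)
  simp [Nat.card_eq_fintype_card, Fintype.card_subtype_compl]
  omega

theorem tetrahedral_orbit_arithmetic {G n k₁ k₂ o₁ o₂ o₃ r₃ s t : ℕ} (hn : 3 ≤ n) (hG : 0 < G)
    (h₁ : o₁ * (n * k₁) = G) (h₂ : o₂ * (n * k₂) = G) (h₃ : o₃ * r₃ = G) (hr₃ : 2 ≤ r₃)
    (hs : s = 0 ∨ G ≤ s) (hts : t * 2 ≤ s) (h : G + s + 2 = o₁ + o₂ + o₃ + t) :
    G = 12 ∧ n = 3 ∧ k₁ = 1 ∧ k₂ = 1 ∧ r₃ = 2 ∧ t = 0 := by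
  have hk₁ : 1 ≤ k₁ := Nat.pos_of_ne_zero (by rintro rfl; simp at h₁; omega)
  have hk₂ : 1 ≤ k₂ := Nat.pos_of_ne_zero (by rintro rfl; simp at h₂; omega)
  have b : ∀ {o r : ℕ} (m : ℕ), o * r = G → m ≤ r → o * m ≤ G := fun m h hm =>
    h ▸ Nat.mul_le_mul_left _ hm
  have a₁ := b 3 h₁ (by nlinarith)
  have a₂ := b 3 h₂ (by nlinarith)
  have a₃ := b 2 h₃ hr₃
  have hr : r₃ = 2 := by
    by_contra hne
    have := b 3 h₃ (by omega)
    omega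
  subst hr
  have hn3 : n = 3 := by
    by_contra hne
    have := b 4 h₁ (by nlinarith [show 4 ≤ n by omega])
    have := b 4 h₂ (by nlinarith [show 4 ≤ n by omega])
    omega
  subst hn3
  have e₁ : k₁ = 1 := by
    by_contra hne
    have := b 6 h₁ (by omega)
    omega
  have e₂ : k₂ = 1 := by
    by_contra hne
    have := b 6 h₂ (by omega)
    omega
  subst e₁ e₂
  omega

theorem nonempty_mulEquiv_kleinFour {N : Type*} [Group N] (hc : Nat.card N = 4)
    (h : ∀ g : N, g ^ 2 = 1) :
    Nonempty (N ≃* Multiplicative (ZMod 2) × Multiplicative (ZMod 2)) := by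
  have : IsKleinFour N :=
    { card_four := hc
      exponent_two := by
        have : Nontrivial N := by
          have := Nat.finite_of_card_ne_zero (α := N) (by omega)
          exact Finite.one_lt_card_iff_nontrivial.1 (by omega)
        exact (Nat.dvd_prime Nat.prime_two).1 (Monoid.exponent_dvd_of_forall_pow_eq_one h)
          |>.resolve_left (by rw [Monoid.exp_eq_one_iff]; exact not_subsingleton N) }
  obtain ⟨e⟩ := IsKleinFour.nonempty_mulEquiv (G₁ := N) (G₂ := Multiplicative (ZMod 2 × ZMod 2))
  exact ⟨e.trans (MulEquiv.prodMultiplicative _ _)⟩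

theorem nonempty_mulEquiv_alternatingGroup {G Y : Type*} [Group G] [MulAction G Y]
    [FaithfulSMul G Y] (hG : Nat.card G = 12) (hY : Nat.card Y = 4) :
    Nonempty (G ≃* alternatingGroup (Fin 4)) := by
  have : Finite Y := Nat.finite_of_card_ne_zero (by omega)
  let e : Y ≃ Fin 4 := Finite.equivFinOfCardEq hY
  let f : G →* Equiv.Perm (Fin 4) := e.permCongrHom.toMonoidHom.comp (toPermHom G Y)
  have hf : Function.Injective f := e.permCongrHom.injective.comp toPerm_injective
  have hr : f.range = alternatingGroup (Fin 4) := by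
    apply Equiv.Perm.eq_alternatingGroup_of_index_eq_two
    have h1 := f.range.card_mul_index
    rw [← Nat.card_congr (f.ofInjective hf).toEquiv, hG, Nat.card_perm, Nat.card_fin] at h1
    have : Nat.factorial 4 = 24 := rfl
    omega
  exact ⟨(f.ofInjective hf).trans (MulEquiv.subgroupCongr hr)⟩

theorem exists_orbit_compl {G X : Type*} [Group G] [MulAction G X] [Finite G]
    {s : X → ℕ} (hs : ∀ x, Nat.card (stabilizer G x) = s x)
    (A : Finset X) (hA : ∀ g : G, ∀ x ∈ A, g • x ∈ A) (hne : A.Nonempty) :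
    ∃ x ∈ A, ∃ B ⊆ A, (∀ g : G, ∀ y ∈ B, g • y ∈ B) ∧
      (∀ y ∈ A, y ∈ B ∨ s y = s x) ∧
      ∑ y ∈ A, s y = Nat.card G + ∑ y ∈ B, s y ∧
      A.card = Nat.card (orbit G x) + B.card ∧
      Nat.card (orbit G x) * s x = Nat.card G := by
  classical
  obtain ⟨x, hx⟩ := hne
  have hO : (((A.filter (· ∈ orbit G x)) : Finset X) : Set X) = orbit G x := by
    ext y
    simp only [Finset.coe_filter, Set.mem_ofPred_eq, and_iff_right_iff_imp]
    rintro ⟨g, rfl⟩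
    exact hA g x hx
  have hcard : (A.filter (· ∈ orbit G x)).card = Nat.card (orbit G x) := by
    rw [← Set.ncard_coe_finset, hO, Nat.card_coe_set_eq]
  have hc : ∀ y : X, Nat.card (orbit G y) * s y = Nat.card G := fun y => by
    rw [← hs, ← Nat.card_prod]
    exact Nat.card_congr (orbitProdStabilizerEquivGroup G y)
  have hpos : 0 < Nat.card (orbit G x) := by
    rw [← hcard, Finset.card_pos]
    exact ⟨x, Finset.mem_filter.2 ⟨hx, mem_orbit_self x⟩⟩
  have hconst : ∀ y ∈ orbit G x, s y = s x := by
    intro y hy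
    apply Nat.eq_of_mul_eq_mul_left hpos
    rw [hc x, ← orbit_eq_iff.2 hy, hc y]
  refine ⟨x, hx, A.filter (· ∉ orbit G x), Finset.filter_subset _ _, ?_, ?_, ?_, ?_, hc x⟩
  · intro g y hy
    rw [Finset.mem_filter] at hy ⊢
    exact ⟨hA g y hy.1, fun h => hy.2 (by simpa using mem_orbit_of_mem_orbit g⁻¹ h)⟩
  · intro y hy
    by_cases h : y ∈ orbit G x
    · exact .inr (hconst y h)
    · exact .inl (Finset.mem_filter.2 ⟨hy, h⟩)
  · rw [← Finset.sum_filter_add_sum_filter_not A (· ∈ orbit G x),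
      Finset.sum_const_nat fun y hy => hconst y (Finset.mem_filter.1 hy).2, hcard, hc]
  · rw [← hcard, Finset.card_filter_add_card_filter_not]

/-- A finite group with a cyclic quotient of order at least three, acting so that every
nontrivial element has exactly two fixed points and every point has nontrivial stabilizer,
either fixes a point or is the tetrahedral group. -/
theorem stabilizer_eq_top_or_tetrahedral {G X : Type*} [Group G] [MulAction G X] [Finite G]
    [Finite X] (h2 : ∀ g : G, g ≠ 1 → Nat.card (fixedBy X g) = 2)
    (hs : ∀ x : X, stabilizer G x ≠ ⊥) (N : Subgroup G) [N.Normal] [IsCyclic (G ⧸ N)]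
    (hn : 3 ≤ Nat.card (G ⧸ N)) :
    (∃ x : X, stabilizer G x = ⊤) ∨
      (Nonempty (N ≃* (Multiplicative (ZMod 2) × Multiplicative (ZMod 2))) ∧
        Nonempty (G ≃* alternatingGroup (Fin 4))) := by
  classical
  have := Fintype.ofFinite X
  obtain ⟨a, ha⟩ := IsCyclic.exists_generator (α := G ⧸ N)
  have ha1 : a ≠ 1 := by
    rintro rfl
    have : Subsingleton (G ⧸ N) :=
      ⟨fun y z => by
        have hy := ha y; have hz := ha z
        rw [Subgroup.zpowers_one_eq_bot, Subgroup.mem_bot] at hy hz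
        rw [hy, hz]⟩
    have := Finite.card_le_one_iff_subsingleton.2 this
    omega
  have hGpos : 0 < Nat.card G := Nat.card_pos
  have hN := N.card_eq_card_quotient_mul_card_subgroup
  obtain ⟨s, hsdef⟩ : ∃ s : X → ℕ, ∀ x, Nat.card (stabilizer G x) = s x := ⟨_, fun _ => rfl⟩
  have hspos : ∀ x, 2 ≤ s x := fun x => by
    have := (stabilizer G x).one_lt_card_iff_ne_bot.2 (hs x)
    rwa [hsdef] at this
  set φ : G →* G ⧸ N := QuotientGroup.mk' N
  set T : Finset X := Finset.univ.filter fun x => ∃ g ∈ stabilizer G x, φ g = a with hT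
  have hTinv : ∀ g : G, ∀ x, x ∈ T → g • x ∈ T := by
    intro g x hx
    simp only [hT, Finset.mem_filter, Finset.mem_univ, true_and, mem_stabilizer_iff] at hx ⊢
    obtain ⟨k, hk, rfl⟩ := hx
    refine ⟨g * k * g⁻¹, by simp [mul_smul, hk], ?_⟩
    have := IsCyclic.isMulCommutative (α := G ⧸ N)
    rw [map_mul, map_mul, mul_comm' (φ g), mul_assoc, ← map_mul]
    simp
  have hTn : ∀ x ∈ T, Nat.card {g : stabilizer G x // φ g = a} * Nat.card (G ⧸ N) = s x := by
    intro x hx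
    obtain ⟨g, hg, hga⟩ := (Finset.mem_filter.1 hx).2
    rw [← hsdef]
    refine card_fiber_mul_card_of_surjective (φ.comp (stabilizer G x).subtype) (fun y => ?_) a
    obtain ⟨m, rfl⟩ := ha y
    exact ⟨⟨g, hg⟩ ^ m, by simp [hga]⟩
  have hsumT : ∑ x ∈ T, s x = 2 * Nat.card G := by
    have h1 := sum_card_fixing_eq_two_mul h2 (fun g => φ g = a) (by simpa using ha1.symm)
    rw [← card_fiber_mul_card_of_surjective φ (QuotientGroup.mk'_surjective N) a, ← mul_assoc, ← h1,
      Finset.sum_mul, ← Finset.sum_congr rfl hTn]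
    refine Finset.sum_subset (Finset.subset_univ _) fun x _ hx => ?_
    have : IsEmpty {g : stabilizer G x // φ g = a} :=
      ⟨fun g => hx (Finset.mem_filter.2 ⟨Finset.mem_univ _, g.1, g.1.2, g.2⟩)⟩
    simp
  have hsum : ∑ x, s x + 2 = 2 * Nat.card G + Fintype.card X := by
    have h1 := sum_card_fixing_eq_two_mul h2 (fun g => g ≠ 1) (by simp)
    have h3 : ∀ x : X, s x = Nat.card {g : stabilizer G x // (g : G) ≠ 1} + 1 := fun x => by
      rw [← hsdef]
      simp only [← card_ne_one_add_one (stabilizer G x), ne_eq, OneMemClass.coe_eq_one]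
    have h4 := card_ne_one_add_one G
    rw [Finset.sum_congr rfl fun x _ => h3 x, Finset.sum_add_distrib, h1]
    simp
    simp at h4
    omega
  have hsplit : ∑ x ∈ T, s x + ∑ x ∈ Tᶜ, s x = ∑ x, s x := Finset.sum_add_sum_compl T s
  have hcsplit := Finset.card_add_card_compl T
  obtain ⟨x₁, hx₁, B₁, hB₁, hinv₁, hor₁, hs₁, hc₁, hos₁⟩ := exists_orbit_compl hsdef T hTinv (by
    rw [Finset.nonempty_iff_ne_empty]; intro h; rw [h] at hsumT; simp at hsumT; omega)
  obtain ⟨x₂, hx₂, B₂, -, -, hor₂, hs₂, hc₂, hos₂⟩ := exists_orbit_compl hsdef B₁ hinv₁ (by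
    rw [Finset.nonempty_iff_ne_empty]; intro h; rw [h] at hs₁; simp at hs₁; omega)
  have hB₂e : B₂ = ∅ := by
    have h0 : ∑ y ∈ B₂, s y = 0 := by omega
    rw [Finset.sum_eq_zero_iff] at h0
    exact Finset.eq_empty_of_forall_notMem fun y hy => by
      have := h0 y hy; have := hspos y; omega
  subst hB₂e
  have hk₁ := hTn x₁ hx₁
  have hk₂ := hTn x₂ (hB₁ hx₂)
  by_cases hR : Tᶜ = ∅
  · left
    refine ⟨x₁, Subgroup.eq_top_of_card_eq _ ?_⟩
    have ho₂ : 0 < Nat.card (orbit G x₂) := Nat.pos_of_ne_zero fun h => by rw [h, zero_mul] at hos₂; omega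
    have ho₁ : 0 < Nat.card (orbit G x₁) := Nat.pos_of_ne_zero fun h => by rw [h, zero_mul] at hos₁; omega
    have ho : Nat.card (orbit G x₁) = 1 := by
      rw [hR, Finset.sum_empty] at hsplit
      rw [hR, Finset.card_empty] at hcsplit
      rw [Finset.card_empty] at hc₂
      omega
    rwa [ho, one_mul, ← hsdef] at hos₁
  · right
    obtain ⟨x₃, -, B₃, -, hinv₃, hor₃, hs₃, hc₃, hos₃⟩ := exists_orbit_compl hsdef Tᶜ
      (fun g x hx => by
        rw [Finset.mem_compl] at hx ⊢
        exact fun h => hx (by simpa using hTinv g⁻¹ _ h)) (Finset.nonempty_iff_ne_empty.2 hR)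
    have hB₃s : ∑ y ∈ B₃, s y = 0 ∨ Nat.card G ≤ ∑ y ∈ B₃, s y := by
      rcases B₃.eq_empty_or_nonempty with h | h
      · left; simp [h]
      · obtain ⟨_, _, _, _, _, _, h, _⟩ := exists_orbit_compl hsdef B₃ hinv₃ h
        right; omega
    have hB₃c : B₃.card * 2 ≤ ∑ y ∈ B₃, s y := by
      simpa using Finset.card_nsmul_le_sum B₃ s 2 fun x _ => hspos x
    obtain ⟨hG, hn3, e₁, e₂, hr, ht⟩ := tetrahedral_orbit_arithmetic hn hGpos
      (by rw [← hk₁, mul_comm (Nat.card {g : stabilizer G x₁ // _})] at hos₁; exact hos₁)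
      (by rw [← hk₂, mul_comm (Nat.card {g : stabilizer G x₂ // _})] at hos₂; exact hos₂) hos₃ (hspos x₃) hB₃s hB₃c (by
        rw [Finset.card_empty] at hc₂
        omega)
    rw [e₁, hn3] at hk₁
    rw [e₂, hn3] at hk₂
    have hcN : Nat.card N = 4 := by rw [hG, hn3] at hN; omega
    refine ⟨nonempty_mulEquiv_kleinFour hcN fun g => ?_, ?_⟩
    · by_cases hg : g = 1
      · simp [hg]
      have hg' : (g : G) ≠ 1 := by simpa using hg
      have : Nonempty (fixedBy X (g : G)) := (Nat.card_pos_iff.1 (by rw [h2 _ hg']; simp)).1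
      obtain ⟨x, hx⟩ := this
      have hd : orderOf (g : G) ∣ s x := hsdef x ▸ Subgroup.orderOf_dvd_natCard _ (mem_stabilizer_iff.2 hx)
      have hd4 : orderOf (g : G) ∣ 4 := hcN ▸ Subgroup.orderOf_dvd_natCard N g.2
      have hsx : s x = 3 ∨ s x = 2 := by
        by_cases hxT : x ∈ T
        · rcases hor₁ x hxT with h | h
          · rcases hor₂ x h with h | h
            · simp at h
            · left; omega
          · left; omega
        · rcases hor₃ x (by simpa using hxT) with h | h
          · rw [Finset.card_eq_zero] at ht; simp [ht] at h
          · right; omega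
      have h2' : orderOf (g : G) ∣ 2 := by
        rcases hsx with h | h
        · rw [h] at hd
          have h1 : orderOf (g : G) ∣ Nat.gcd 3 4 := Nat.dvd_gcd hd hd4
          exact h1.trans (by norm_num)
        · rwa [h] at hd
      have := orderOf_dvd_iff_pow_eq_one.1 h2'
      exact_mod_cast this
    · have hos : Nat.card (orbit G x₁) = 4 := by
        rw [← hk₁] at hos₁; omega
      have : FaithfulSMul G (orbit G x₁) := by
        constructor
        intro g k hgk
        by_contra hne
        have h := h2 (k⁻¹ * g) (fun h => hne (by rw [inv_mul_eq_one] at h; exact h.symm))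
        have hle : Nat.card (orbit G x₁) ≤ Nat.card (fixedBy X (k⁻¹ * g)) :=
          Nat.card_mono (Set.toFinite _) fun y hy => by
            have := congrArg Subtype.val (hgk ⟨y, hy⟩)
            simp only [orbit.coe_smul] at this
            rw [mem_fixedBy, mul_smul, this, inv_smul_smul]
        omega
      exact nonempty_mulEquiv_alternatingGroup hG hos

theorem cross_mulVec_of_mem_orthogonalGroup {A : Matrix (Fin 3) (Fin 3) ℝ}
    (hA : A ∈ orthogonalGroup (Fin 3) ℝ) (hd : A.det = 1) (v w : Fin 3 → ℝ) :
    (A *ᵥ v) ⨯₃ (A *ᵥ w) = A *ᵥ (v ⨯₃ w) := by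
  have h1 : Aᵀ *ᵥ ((A *ᵥ v) ⨯₃ (A *ᵥ w)) = A.det • (v ⨯₃ w) := by
    rw [det_fin_three]
    ext i
    fin_cases i <;>
    · simp [cross_apply, mulVec, dotProduct, Fin.sum_univ_three]
      ring
  rw [hd, one_smul] at h1
  rw [← h1, mulVec_mulVec, (mem_orthogonalGroup_iff _ _).1 hA, one_mulVec]

theorem dotProduct_mulVec_of_mem_orthogonalGroup {m : Type*} [Fintype m] [DecidableEq m]
    {A : Matrix m m ℝ} (hA : A ∈ orthogonalGroup m ℝ) (v w : m → ℝ) :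
    (A *ᵥ v) ⬝ᵥ (A *ᵥ w) = v ⬝ᵥ w := by
  rw [dotProduct_mulVec, vecMul_mulVec, (mem_orthogonalGroup_iff' _ _).1 hA, vecMul_one]

theorem eq_one_of_mulVec_eq_of_cross_ne_zero {A : Matrix (Fin 3) (Fin 3) ℝ}
    (hA : A ∈ orthogonalGroup (Fin 3) ℝ) (hd : A.det = 1) {v w : Fin 3 → ℝ}
    (hv : A *ᵥ v = v) (hw : A *ᵥ w = w) (hvw : v ⨯₃ w ≠ 0) : A = 1 := by
  have hu : A *ᵥ (v ⨯₃ w) = v ⨯₃ w := by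
    rw [← cross_mulVec_of_mem_orthogonalGroup hA hd, hv, hw]
  let M : Matrix (Fin 3) (Fin 3) ℝ := ![v, w, v ⨯₃ w]
  have hM : IsUnit M.det := by
    rw [isUnit_iff_ne_zero, ← triple_product_eq_det, triple_product_permutation,
      triple_product_permutation]
    exact fun h => hvw (dotProduct_self_eq_zero.1 h)
  have hMA : M * Aᵀ = 1 * M := by
    ext i j
    rw [one_mul, mul_apply_eq_vecMul, vecMul_transpose]
    fin_cases i
    · exact congrFun hv j
    · exact congrFun hw j
    · exact congrFun hu j
  have : Aᵀ = 1 := by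
    rw [one_mul] at hMA
    simpa [nonsing_inv_mul_cancel_left _ _ hM, nonsing_inv_mul _ hM] using
      congrArg (M⁻¹ * ·) hMA
  simpa using congrArg transpose this

theorem exists_smul_dotProduct_self_eq_one {m : Type*} [Fintype m] {w : m → ℝ} (hw : w ≠ 0) :
    ∃ c : ℝ, (c • w) ⬝ᵥ (c • w) = 1 := by
  have hpos : 0 < w ⬝ᵥ w := lt_of_le_of_ne (Finset.sum_nonneg fun i _ => mul_self_nonneg (w i))
    fun h => hw (dotProduct_self_eq_zero.1 h.symm)
  refine ⟨(√(w ⬝ᵥ w))⁻¹, ?_⟩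
  rw [smul_dotProduct, dotProduct_smul, smul_eq_mul, smul_eq_mul, ← mul_assoc, ← mul_inv,
    Real.mul_self_sqrt hpos.le, inv_mul_cancel₀ hpos.ne']

theorem exists_unit_axis {A : Matrix (Fin 3) (Fin 3) ℝ} (hA : A ∈ orthogonalGroup (Fin 3) ℝ)
    (hd : A.det = 1) : ∃ v : Fin 3 → ℝ, v ⬝ᵥ v = 1 ∧ A *ᵥ v = v := by
  have h0 : (A - 1).det = 0 := by
    have h1 : A - 1 = A * (1 - A)ᵀ := by
      rw [transpose_sub, mul_sub, transpose_one, mul_one, (mem_orthogonalGroup_iff _ _).1 hA]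
    have h2 : (A - 1).det = (1 - A).det := by
      conv_lhs => rw [h1, det_mul, hd, one_mul, det_transpose]
    have h3 : (1 - A).det = -(A - 1).det := by
      rw [← neg_sub, det_neg]
      norm_num
    linarith
  obtain ⟨v, hv, hAv⟩ := exists_mulVec_eq_zero_iff.2 h0
  rw [sub_mulVec, one_mulVec, sub_eq_zero] at hAv
  obtain ⟨c, hc⟩ := exists_smul_dotProduct_self_eq_one hv
  exact ⟨c • v, hc, by rw [mulVec_smul, hAv]⟩

theorem eq_or_eq_neg_of_cross_eq_zero {v w : Fin 3 → ℝ} (hv : v ⬝ᵥ v = 1) (hw : w ⬝ᵥ w = 1)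
    (h : v ⨯₃ w = 0) : w = v ∨ w = -v := by
  have h1 := cross_dot_cross v w v w
  rw [h, zero_dotProduct, hv, hw, dotProduct_comm w v] at h1
  have h2 : (v ⬝ᵥ w - 1) * (v ⬝ᵥ w + 1) = 0 := by linarith
  rcases mul_eq_zero.1 h2 with h3 | h3
  · left
    rw [← sub_eq_zero, ← dotProduct_self_eq_zero]
    rw [sub_dotProduct, dotProduct_sub, dotProduct_sub, hv, hw, dotProduct_comm w v]
    linarith
  · right
    rw [← sub_eq_zero, ← dotProduct_self_eq_zero, sub_neg_eq_add]
    rw [add_dotProduct, dotProduct_add, dotProduct_add, hv, hw, dotProduct_comm w v]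
    linarith

theorem ncard_unit_fixed_eq_two {A : Matrix (Fin 3) (Fin 3) ℝ}
    (hA : A ∈ orthogonalGroup (Fin 3) ℝ) (hd : A.det = 1) (hA1 : A ≠ 1) :
    {v : Fin 3 → ℝ | v ⬝ᵥ v = 1 ∧ A *ᵥ v = v}.ncard = 2 := by
  obtain ⟨v, hv, hAv⟩ := exists_unit_axis hA hd
  have hset : {v : Fin 3 → ℝ | v ⬝ᵥ v = 1 ∧ A *ᵥ v = v} = {v, -v} := by
    ext w
    constructor
    · rintro ⟨hw, hAw⟩
      refine eq_or_eq_neg_of_cross_eq_zero hv hw (by_contra fun h => hA1 ?_)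
      exact eq_one_of_mulVec_eq_of_cross_ne_zero hA hd hAv hAw h
    · rintro (rfl | rfl)
      · exact ⟨hv, hAv⟩
      · exact ⟨by simpa using hv, by rw [mulVec_neg, hAv]⟩
  rw [hset, Set.ncard_pair]
  intro h
  rw [self_eq_neg.1 h, zero_dotProduct] at hv
  exact zero_ne_one hv

theorem exists_unit_orthogonal (v : Fin 3 → ℝ) :
    ∃ w : Fin 3 → ℝ, w ⬝ᵥ w = 1 ∧ w ⬝ᵥ v = 0 := by
  obtain ⟨w, hw, hwv⟩ : ∃ w : Fin 3 → ℝ, w ≠ 0 ∧ w ⬝ᵥ v = 0 := by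
    by_cases h : v 0 = 0
    · exact ⟨![1, 0, 0], fun h' => by simpa using congrFun h' 0, by
        simp [dotProduct, Fin.sum_univ_three, h]⟩
    · exact ⟨![-v 1, v 0, 0], fun h' => h (by simpa using congrFun h' 1), by
        simp [dotProduct, Fin.sum_univ_three]; ring⟩
  obtain ⟨c, hc⟩ := exists_smul_dotProduct_self_eq_one hw
  exact ⟨c • w, hc, by rw [smul_dotProduct, hwv, smul_zero]⟩

theorem isCyclic_of_forall_mulVec_eq (K : Subgroup (orthogonalGroup (Fin 3) ℝ)) [Finite K]
    (hdet : ∀ A ∈ K, (A : Matrix (Fin 3) (Fin 3) ℝ).det = 1) {v : Fin 3 → ℝ} (hv : v ⬝ᵥ v = 1)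
    (hfix : ∀ A ∈ K, (A : Matrix (Fin 3) (Fin 3) ℝ) *ᵥ v = v) : IsCyclic K := by
  obtain ⟨w, hw, hwv⟩ := exists_unit_orthogonal v
  obtain ⟨u, hu⟩ : ∃ u, u = v ⨯₃ w := ⟨_, rfl⟩
  have hwu : w ⬝ᵥ u = 0 := by rw [hu, dot_cross_self]
  have huw : u ⬝ᵥ w = 0 := by rw [dotProduct_comm, hwu]
  have huu : u ⬝ᵥ u = 1 := by
    rw [hu, cross_dot_cross, hv, hw, hwv, dotProduct_comm v w, hwv]; norm_num
  have huvw : u ⨯₃ v = w := by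
    rw [hu, cross_cross_eq_smul_sub_smul, hv, hwv, one_smul, zero_smul, sub_zero]
  have hdecomp : ∀ x : Fin 3 → ℝ, x ⬝ᵥ v = 0 → x = (x ⬝ᵥ w) • w + (x ⬝ᵥ u) • u := by
    intro x hx
    have h1 : x ⨯₃ u = (x ⬝ᵥ w) • v := by
      rw [hu, cross_cross_eq_smul_sub_smul', dotProduct_comm v x, hx, zero_smul, sub_zero]
    have h2 := cross_cross_eq_smul_sub_smul' u x u
    rw [h1, huu, one_smul, map_smul, huvw] at h2
    rw [h2, sub_add_cancel]
  have hAw : ∀ A ∈ K, (A : Matrix (Fin 3) (Fin 3) ℝ) *ᵥ w =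
      ((A : Matrix (Fin 3) (Fin 3) ℝ) *ᵥ w ⬝ᵥ w) • w +
        ((A : Matrix (Fin 3) (Fin 3) ℝ) *ᵥ w ⬝ᵥ u) • u := by
    intro A hA
    apply hdecomp
    rw [← hwv, ← dotProduct_mulVec_of_mem_orthogonalGroup A.2 w v, hfix A hA]
  have hAu : ∀ A ∈ K, (A : Matrix (Fin 3) (Fin 3) ℝ) *ᵥ u =
      ((A : Matrix (Fin 3) (Fin 3) ℝ) *ᵥ w ⬝ᵥ w) • u -
        ((A : Matrix (Fin 3) (Fin 3) ℝ) *ᵥ w ⬝ᵥ u) • w := by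
    intro A hA
    conv_lhs => rw [hu, ← cross_mulVec_of_mem_orthogonalGroup A.2 (hdet A hA), hfix A hA, hAw A hA]
    rw [map_add, map_smul, map_smul, ← hu, ← cross_anticomm u v, huvw, smul_neg, sub_eq_add_neg]
  let f : K →* ℂ :=
    { toFun := fun A => ⟨(A : Matrix (Fin 3) (Fin 3) ℝ) *ᵥ w ⬝ᵥ w,
        (A : Matrix (Fin 3) (Fin 3) ℝ) *ᵥ w ⬝ᵥ u⟩
      map_one' := by
        simp [hw, hwu, Complex.ext_iff]
      map_mul' := by
        rintro ⟨A, hA⟩ ⟨B, hB⟩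
        have h : ((A * B : orthogonalGroup (Fin 3) ℝ) : Matrix (Fin 3) (Fin 3) ℝ) *ᵥ w =
            (A : Matrix (Fin 3) (Fin 3) ℝ) *ᵥ ((B : Matrix (Fin 3) (Fin 3) ℝ) *ᵥ w) := by
          simp [mulVec_mulVec]
        rw [hAw B hB, mulVec_add, mulVec_smul, mulVec_smul, hAu A hA, hAw A hA] at h
        apply Complex.ext
        · simp only [MulMemClass.mk_mul_mk, h, Complex.mul_re]
          simp only [add_dotProduct, sub_dotProduct, smul_dotProduct, smul_eq_mul, hw, huw, hwu, huu, smul_add,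
            smul_sub]
          ring
        · simp only [MulMemClass.mk_mul_mk, h, Complex.mul_im]
          simp only [add_dotProduct, sub_dotProduct, smul_dotProduct, smul_eq_mul, hw, huw, hwu, huu, smul_add,
            smul_sub]
          ring }
  refine isCyclic_of_injective_ringHom f ((injective_iff_map_eq_one f).2 ?_)
  rintro ⟨A, hA⟩ h
  have hre : (A : Matrix (Fin 3) (Fin 3) ℝ) *ᵥ w ⬝ᵥ w = 1 := congrArg Complex.re h
  have him : (A : Matrix (Fin 3) (Fin 3) ℝ) *ᵥ w ⬝ᵥ u = 0 := congrArg Complex.im h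
  have hfw := hAw A hA
  rw [hre, him, one_smul, zero_smul, add_zero] at hfw
  have hA1 := eq_one_of_mulVec_eq_of_cross_ne_zero A.2 (hdet A hA) (hfix A hA) hfw (by
    rw [← hu]
    rintro rfl
    simp at huu)
  exact Subtype.ext (Subtype.ext hA1)

/-- The poles of a group of orthogonal matrices: the unit vectors fixed by some nontrivial
element. -/
def poleSet (K : Subgroup (orthogonalGroup (Fin 3) ℝ)) : Set (Fin 3 → ℝ) :=
  {v | v ⬝ᵥ v = 1 ∧ ∃ A ∈ K, A ≠ 1 ∧ (A : Matrix (Fin 3) (Fin 3) ℝ) *ᵥ v = v}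

instance poleSetMulAction (K : Subgroup (orthogonalGroup (Fin 3) ℝ)) :
    MulAction K (poleSet K) where
  smul A v := ⟨(A : Matrix (Fin 3) (Fin 3) ℝ) *ᵥ v.1, by
    obtain ⟨v, hv, B, hB, hB1, hBv⟩ := v
    refine ⟨by rw [dotProduct_mulVec_of_mem_orthogonalGroup A.1.2, hv], A * B * A⁻¹,
      K.mul_mem (K.mul_mem A.2 hB) (K.inv_mem A.2), by simpa [mul_inv_eq_one] using hB1, ?_⟩
    have h : ((A : orthogonalGroup (Fin 3) ℝ) * B * (A : orthogonalGroup (Fin 3) ℝ)⁻¹) * A =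
        A * B := inv_mul_cancel_right _ _
    have h' := congrArg (fun C : orthogonalGroup (Fin 3) ℝ =>
      (C : Matrix (Fin 3) (Fin 3) ℝ) *ᵥ v) h
    simp only [Submonoid.coe_mul, ← mulVec_mulVec, hBv] at h'
    simp only [Submonoid.coe_mul, ← mulVec_mulVec]
    exact h'⟩
  one_smul v := Subtype.ext (one_mulVec v.1)
  mul_smul A B v := Subtype.ext (mulVec_mulVec v.1 _ _).symm

theorem finite_poleSet (K : Subgroup (orthogonalGroup (Fin 3) ℝ)) [Finite K]
    (hdet : ∀ A ∈ K, (A : Matrix (Fin 3) (Fin 3) ℝ).det = 1) : (poleSet K).Finite := by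
  refine (Set.finite_iUnion (ι := {A : K // A ≠ 1}) (f := fun A => {v : Fin 3 → ℝ | v ⬝ᵥ v = 1 ∧
    (A : Matrix (Fin 3) (Fin 3) ℝ) *ᵥ v = v}) fun A => ?_).subset ?_
  · refine Set.finite_of_ncard_ne_zero ?_
    rw [ncard_unit_fixed_eq_two A.1.1.2 (hdet _ A.1.2)]
    · simp
    · exact fun h => A.2 (Subtype.ext (Subtype.ext h))
  · rintro v ⟨hv, A, hA, hA1, hAv⟩
    exact Set.mem_iUnion.2 ⟨⟨⟨A, hA⟩, fun h => hA1 (congrArg Subtype.val h)⟩, hv, hAv⟩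

theorem card_fixedBy_poleSet {K : Subgroup (orthogonalGroup (Fin 3) ℝ)}
    (hdet : ∀ A ∈ K, (A : Matrix (Fin 3) (Fin 3) ℝ).det = 1) {A : K} (hA : A ≠ 1) :
    Nat.card (fixedBy (poleSet K) A) = 2 := by
  have hA1 : (A : Matrix (Fin 3) (Fin 3) ℝ) ≠ 1 := fun h => hA (Subtype.ext (Subtype.ext h))
  rw [← ncard_unit_fixed_eq_two A.1.2 (hdet A A.2) hA1, Nat.card_coe_set_eq,
    ← Set.ncard_image_of_injective _ Subtype.val_injective]
  congr 1
  ext v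
  constructor
  · rintro ⟨x, hx, rfl⟩
    exact ⟨x.2.1, congrArg Subtype.val hx⟩
  · rintro ⟨hv, hAv⟩
    exact ⟨⟨v, hv, A, A.2, fun h => hA (Subtype.ext h), hAv⟩, Subtype.ext hAv, rfl⟩

theorem stabilizer_poleSet_ne_bot {K : Subgroup (orthogonalGroup (Fin 3) ℝ)} (v : poleSet K) :
    stabilizer K v ≠ ⊥ := by
  obtain ⟨v, hv, A, hA, hA1, hAv⟩ := v
  intro h
  have hm : (⟨A, hA⟩ : K) ∈ stabilizer K (⟨v, hv, A, hA, hA1, hAv⟩ : poleSet K) :=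
    Subtype.ext hAv
  rw [h, Subgroup.mem_bot] at hm
  exact hA1 (congrArg Subtype.val hm)

/-- **Finite subgroups of SO(3) with large cyclic quotient.**
Let `K` be a finite subgroup of the rotation group `SO(3)` (formalized as a subgroup of the
group of orthogonal `3×3` real matrices, all of whose elements have determinant `1`) and let
`N` be a normal subgroup of `K` such that `K/N` is cyclic of order `n` for some `n ≥ 3`.
Then either `K` is cyclic, or `N` is isomorphic to the Klein four-group `ℤ/2 × ℤ/2` and `K`
is isomorphic to the tetrahedral group, i.e. the alternating group `A₄` on four letters. -/
theorem finite_subgroup_SO3_cyclic_quotient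
    (K : Subgroup (Matrix.orthogonalGroup (Fin 3) ℝ)) [Finite K]
    (hdet : ∀ A ∈ K, ((A : Matrix (Fin 3) (Fin 3) ℝ)).det = 1)
    (N : Subgroup K) [N.Normal] (n : ℕ) (hn : 3 ≤ n)
    (hcyc : IsCyclic (K ⧸ N)) (hcard : Nat.card (K ⧸ N) = n) :
    IsCyclic K ∨
      (Nonempty (N ≃* (Multiplicative (ZMod 2) × Multiplicative (ZMod 2))) ∧
        Nonempty (K ≃* alternatingGroup (Fin 4))) := by
  have : Finite (poleSet K) := finite_poleSet K hdet
  rcases stabilizer_eq_top_or_tetrahedral (X := poleSet K)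
    (fun A hA => card_fixedBy_poleSet hdet hA) stabilizer_poleSet_ne_bot N (hcard ▸ hn) with
    ⟨v, hv⟩ | h
  · refine .inl (isCyclic_of_forall_mulVec_eq K hdet v.2.1 fun A hA => ?_)
    have hm : (⟨A, hA⟩ : K) ∈ stabilizer K v := hv ▸ Subgroup.mem_top _
    exact congrArg Subtype.val (mem_stabilizer_iff.1 hm)
  · exact .inr h
end
end
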